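/- Let (Ω, Σ, μ) be a measure space, 1 ≤ p < ∞, O ⊆ ℂᵈ open, and f : O × Ω → ℂ such that f(z,·) is measurable for each z with sup_{z ∈ O} ∫_Ω |f(z,t)|^p μ(dt) < ∞, and f(·,t) is bounded holomorphic for each t. Then the map F : O → L^p(Ω), F(z) = [f(z,·)], is a bounded holomorphic L^p-valued function, and for every multi-index α and a ∈ O, D^α F(a) = D^α_z f(a, ·) μ-almost everywhere. -/

import Mathlib

open MeasureTheory ENNReal

/-- partial complex derivative in coordinate direction `j` -/
noncomputable def pderiv' {E : Type*} [NormedAddCommGroup E] [NormedSpace ℂ E]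
    {d : ℕ} (j : Fin d) (f : (Fin d → ℂ) → E) : (Fin d → ℂ) → E :=
  fun z => fderiv ℂ f z (Pi.single j 1)

/-- iterated partial derivative `D^α = ∏_j (∂/∂z_j)^{α_j}` for a multi-index `α ∈ ℕ₀ᵈ` -/
noncomputable def Dpartial {E : Type*} [NormedAddCommGroup E] [NormedSpace ℂ E]
    {d : ℕ} (α : Fin d → ℕ) (f : (Fin d → ℂ) → E) : (Fin d → ℂ) → E :=
  Fin.foldr d (fun j g => (pderiv' j)^[α j] g) f


section Helpers

open Filter Topology Metric

/-- Left Riemann sums of a continuous function converge to its integral. -/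
theorem tendsto_riemannSum_of_continuous {f : ℝ → ℂ} (hf : Continuous f) {b : ℝ} (hb : 0 ≤ b) :
    Tendsto (fun N : ℕ => ∑ k ∈ Finset.range (N + 1), ((b / (N + 1) : ℝ) : ℂ) * f (k * (b / (N + 1))))
      atTop (𝓝 (∫ x in (0 : ℝ)..b, f x)) := by
  rw [Metric.tendsto_atTop]
  intro ε hε
  obtain ⟨δ, hδ, hu⟩ := Metric.uniformContinuousOn_iff.1
    (isCompact_Icc.uniformContinuousOn_of_continuous (hf.continuousOn (s := Set.Icc 0 b)))
    (ε / (b + 1)) (by positivity)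
  obtain ⟨N₀, hN₀⟩ := exists_nat_gt (b / δ)
  refine ⟨N₀, fun N hN => ?_⟩
  set h : ℝ := b / (N + 1) with hh
  have hNh : (N + 1) * h = b := by rw [hh]; field_simp
  have h0 : 0 ≤ h := by positivity
  have hhδ : h < δ := by
    rw [hh, div_lt_iff₀ (by positivity)]
    rw [div_lt_iff₀ hδ] at hN₀
    have : (N₀ : ℝ) ≤ N := by exact_mod_cast hN
    nlinarith
  have hsum : ∑ k ∈ Finset.range (N + 1), ∫ x in ((k : ℕ) * h)..((k + 1 : ℕ) * h), f x
      = ∫ x in (0 : ℝ)..b, f x := by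
    rw [intervalIntegral.sum_integral_adjacent_intervals (a := fun k : ℕ => (k : ℝ) * h)
      (fun k _ => hf.intervalIntegrable _ _)]
    simp [hNh]
  rw [← hsum, dist_eq_norm, ← Finset.sum_sub_distrib]
  have hterm : ∀ k ∈ Finset.range (N + 1),
      ‖(h : ℂ) * f (k * h) - ∫ x in ((k : ℕ) * h)..((k + 1 : ℕ) * h), f x‖ ≤ ε / (b + 1) * h := by
    intro k hk
    have hk' : ((k : ℝ) + 1) ≤ N + 1 := by exact_mod_cast Finset.mem_range.1 hk
    have hle : ((k : ℕ) * h) ≤ ((k + 1 : ℕ) * h) := by push_cast; nlinarith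
    have hkb : ((k : ℝ) + 1) * h ≤ b := by rw [← hNh]; gcongr
    have hc : (h : ℂ) * f (k * h) = ∫ x in ((k : ℕ) * h)..((k + 1 : ℕ) * h), f (k * h) := by
      rw [intervalIntegral.integral_const, Complex.real_smul]
      push_cast; ring
    rw [hc, ← intervalIntegral.integral_sub (by simp) (hf.intervalIntegrable _ _)]
    refine (intervalIntegral.norm_integral_le_of_norm_le_const (C := ε / (b + 1)) ?_).trans ?_
    · intro x hx
      rw [Set.uIoc_of_le hle] at hx
      have h1 := hx.1
      have h2 := hx.2
      push_cast at h2
      have hk0 : 0 ≤ (k : ℝ) * h := by positivity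
      rw [← dist_eq_norm]
      refine (hu _ ⟨hk0, by linarith⟩ _ ⟨by linarith, by linarith⟩ ?_).le
      rw [Real.dist_eq, abs_lt]
      constructor <;> nlinarith
    · rw [abs_of_nonneg (by linarith)]
      apply le_of_eq
      push_cast; ring
  refine (norm_sum_le_of_le _ hterm).trans_lt ?_
  rw [Finset.sum_const, Finset.card_range, nsmul_eq_mul]
  push_cast
  have : ((N : ℝ) + 1) * (ε / (b + 1) * h) = ε / (b + 1) * b := by rw [← hNh]; ring
  rw [this, div_mul_eq_mul_div, div_lt_iff₀ (by positivity)]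
  nlinarith

variable {Ω : Type*} [MeasurableSpace Ω] {μ : Measure Ω} {p : ℝ≥0∞}

/-- Minkowski's integral inequality for integrands that are continuous in the parameter; no joint
measurability or σ-finiteness is needed. -/
theorem eLpNorm_intervalIntegral_le (hp : 1 ≤ p) {G : ℝ → Ω → ℂ}
    (hc : ∀ t, Continuous fun x => G x t) (hm : ∀ x, AEStronglyMeasurable (G x) μ)
    {C : ℝ≥0∞} (hC : ∀ x, eLpNorm (G x) p μ ≤ C) {b : ℝ} (hb : 0 ≤ b) :
    AEStronglyMeasurable (fun t => ∫ x in (0 : ℝ)..b, G x t) μ ∧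
      eLpNorm (fun t => ∫ x in (0 : ℝ)..b, G x t) p μ ≤ ENNReal.ofReal b * C := by
  set S : ℕ → Ω → ℂ := fun N =>
    ∑ k ∈ Finset.range (N + 1), (((b / (N + 1) : ℝ) : ℂ)) • G (k * (b / (N + 1))) with hS
  have hSm : ∀ N, AEStronglyMeasurable (S N) μ := fun N =>
    Finset.aestronglyMeasurable_sum _ fun k _ => (hm _).const_smul _
  have hlim : ∀ᵐ t ∂μ, Tendsto (fun N => S N t) atTop (𝓝 (∫ x in (0 : ℝ)..b, G x t)) := by
    refine ae_of_all _ fun t => ?_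
    simpa [hS] using tendsto_riemannSum_of_continuous (hc t) hb
  refine ⟨aestronglyMeasurable_of_tendsto_ae _ hSm hlim, ?_⟩
  refine (Lp.eLpNorm_lim_le_liminf_eLpNorm hSm _ hlim).trans ?_
  refine liminf_le_of_le (by isBoundedDefault) fun B hB => ?_
  obtain ⟨N, hN⟩ := hB.exists
  refine hN.trans ((eLpNorm_sum_le (fun k _ => (hm _).const_smul _) hp).trans ?_)
  have : ∀ k ∈ Finset.range (N + 1),
      eLpNorm ((((b / (N + 1) : ℝ) : ℂ)) • G (k * (b / (N + 1)))) p μ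
        ≤ ENNReal.ofReal (b / (N + 1)) * C := by
    intro k _
    rw [eLpNorm_const_smul, ← ofReal_norm, Complex.norm_real, Real.norm_of_nonneg (by positivity)]
    gcongr
    exact hC _
  refine (Finset.sum_le_sum this).trans (le_of_eq ?_)
  rw [Finset.sum_const, Finset.card_range, nsmul_eq_mul, ← mul_assoc]
  congr 1
  rw [← ENNReal.ofReal_natCast, ← ENNReal.ofReal_mul (by positivity)]
  congr 1
  push_cast
  field_simp

/-- `L^p` bound for a circle integral depending on a parameter. -/
theorem eLpNorm_circleIntegral_le (hp : 1 ≤ p) {g : ℂ → Ω → ℂ} {c : ℂ} {R : ℝ} (hR : 0 ≤ R)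
    (hc : ∀ t, ContinuousOn (fun w => g w t) (sphere c R))
    (hm : ∀ w ∈ sphere c R, AEStronglyMeasurable (g w) μ)
    {C : ℝ≥0∞} (hC : ∀ w ∈ sphere c R, eLpNorm (g w) p μ ≤ C) :
    AEStronglyMeasurable (fun t => ∮ w in C(c, R), g w t) μ ∧
      eLpNorm (fun t => ∮ w in C(c, R), g w t) p μ ≤ ENNReal.ofReal (2 * Real.pi * R) * C := by
  have hmem := circleMap_mem_sphere c hR
  have := eLpNorm_intervalIntegral_le (μ := μ) hp
    (G := fun θ => deriv (circleMap c R) θ • g (circleMap c R θ)) (C := ENNReal.ofReal R * C)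
    (fun t => ?_) (fun θ => (hm _ (hmem θ)).const_smul _) (fun θ => ?_) Real.two_pi_pos.le
  · refine ⟨this.1, this.2.trans (le_of_eq ?_)⟩
    rw [← mul_assoc, ← ENNReal.ofReal_mul Real.two_pi_pos.le]
  · simp only [Pi.smul_apply, deriv_circleMap]
    refine ((continuous_circleMap 0 R).mul continuous_const).smul ?_
    exact (hc t).comp_continuous (continuous_circleMap c R) hmem
  · rw [eLpNorm_const_smul, ← ofReal_norm]
    gcongr
    · simp [deriv_circleMap, abs_of_nonneg hR]
    · exact hC _ (hmem θ)

/-- Cauchy's formula for the second order Taylor remainder. -/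
theorem taylor_remainder_eq_circleIntegral {g : ℂ → ℂ} {s : ℝ} (hs : 1 < s)
    (hg : DiffContOnCl ℂ g (ball 0 s)) :
    g 1 - g 0 - deriv g 0 =
      (2 * Real.pi * Complex.I : ℂ)⁻¹ * ∮ w in C(0, s), (w ^ 2 * (w - 1))⁻¹ * g w := by
  have hs0 : 0 < s := by linarith
  have e1 := hg.two_pi_i_inv_smul_circleIntegral_sub_inv_smul (w := 1) (by simpa using hs)
  have e0 := hg.two_pi_i_inv_smul_circleIntegral_sub_inv_smul (w := 0) (by simpa using hs0)
  have e2 := hg.deriv_eq_smul_circleIntegral hs0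
  have e2' : deriv g 0 = (2 * Real.pi * Complex.I : ℂ)⁻¹ • ∮ w in C(0, s), (1 / (w - 0) ^ 2) • g w := by
    rw [e2, inv_smul_smul₀ Complex.two_pi_I_ne_zero]
  have hgc : ContinuousOn g (sphere 0 s) := hg.continuousOn_ball.mono sphere_subset_closedBall
  have hne : ∀ w ∈ sphere (0 : ℂ) s, w ≠ 0 ∧ w - 1 ≠ 0 := by
    intro w hw
    have hw' : ‖w‖ = s := by simpa using hw
    refine ⟨fun h => ?_, fun h => ?_⟩
    · rw [h, norm_zero] at hw'; linarith
    · rw [sub_eq_zero.1 h, norm_one] at hw'; linarith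
  have i1 : CircleIntegrable (fun w => (w - 1)⁻¹ • g w) 0 s :=
    (((continuousOn_id.sub continuousOn_const).inv₀ fun w hw => (hne w hw).2).smul
      hgc).circleIntegrable hs0.le
  have i0 : CircleIntegrable (fun w => (w - 0)⁻¹ • g w) 0 s :=
    (((continuousOn_id.sub continuousOn_const).inv₀ fun w hw => by
      simpa using (hne w hw).1).smul hgc).circleIntegrable hs0.le
  have i2 : CircleIntegrable (fun w => (1 / (w - 0) ^ 2) • g w) 0 s :=
    ((continuousOn_const.div ((continuousOn_id.sub continuousOn_const).pow 2) fun w hw => by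
      simpa using (hne w hw).1).smul hgc).circleIntegrable hs0.le
  rw [e2', ← e0, ← e1, ← smul_sub, ← smul_sub, ← circleIntegral.integral_sub i1 i0,
    ← circleIntegral.integral_sub (by exact i1.sub i0) i2, smul_eq_mul]
  congr 1
  refine circleIntegral.integral_congr hs0.le fun w hw => ?_
  obtain ⟨h0, h1⟩ := hne w hw
  simp only [smul_eq_mul, sub_zero]
  field_simp
  ring

variable {V : Type*} [NormedAddCommGroup V] [NormedSpace ℂ V]

/-- The slice `w ↦ f (a + w • h)` of a holomorphic function. -/
theorem diffContOnCl_slice {E : Type*} [NormedAddCommGroup E] [NormedSpace ℂ E] {f : V → E}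
    {a h : V} {R s : ℝ} (hf : DifferentiableOn ℂ f (ball a R)) (hs : s * ‖h‖ < R) :
    DiffContOnCl ℂ (fun w : ℂ => f (a + w • h)) (ball 0 s) := by
  refine DifferentiableOn.diffContOnCl ?_
  refine hf.comp (by fun_prop) fun w hw => ?_
  have hw' : ‖w‖ ≤ s := by simpa using closure_ball_subset_closedBall hw
  rw [mem_ball_iff_norm, add_sub_cancel_left, norm_smul]
  exact (mul_le_mul_of_nonneg_right hw' (norm_nonneg h)).trans_lt hs

theorem deriv_slice {E : Type*} [NormedAddCommGroup E] [NormedSpace ℂ E] {f : V → E}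
    {a h : V} (hf : DifferentiableAt ℂ f a) :
    deriv (fun w : ℂ => f (a + w • h)) 0 = fderiv ℂ f a h := by
  have h1 : HasDerivAt (fun w : ℂ => a + w • h) h 0 := by
    simpa using ((hasDerivAt_id (0 : ℂ)).smul_const h).const_add a
  have h2 : HasFDerivAt f (fderiv ℂ f a) (a + (0 : ℂ) • h) := by simpa using hf.hasFDerivAt
  exact (h2.comp_hasDerivAt (0 : ℂ) h1).deriv

/-- Quadratic `L^p` bound for the first order Taylor remainder of a family of holomorphic
functions that is bounded in `L^p`. -/
theorem eLpNorm_taylor_remainder_le (hp : 1 ≤ p) {f : V → Ω → ℂ} {a : V} {R : ℝ} (hR : 0 < R)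
    (hm : ∀ z ∈ ball a R, AEStronglyMeasurable (f z) μ)
    {C : ℝ≥0∞} (hC : ∀ z ∈ ball a R, eLpNorm (f z) p μ ≤ C)
    (hd : ∀ t, DifferentiableOn ℂ (fun z => f z t) (ball a R)) {h : V} (hh : ‖h‖ ≤ R / 4) :
    AEStronglyMeasurable (fun t => f (a + h) t - f a t - fderiv ℂ (fun z => f z t) a h) μ ∧
      eLpNorm (fun t => f (a + h) t - f a t - fderiv ℂ (fun z => f z t) a h) p μ ≤
        ENNReal.ofReal (8 * ‖h‖ ^ 2 / R ^ 2) * C := by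
  rcases eq_or_ne h 0 with rfl | hne
  · simp [aestronglyMeasurable_const]
  have hpos : 0 < ‖h‖ := norm_pos_iff.2 hne
  set s : ℝ := R / (2 * ‖h‖) with hs
  have hs2 : 2 ≤ s := by rw [hs, le_div_iff₀ (by positivity)]; linarith
  have hsh : s * ‖h‖ = R / 2 := by rw [hs]; field_simp
  have hsR : s * ‖h‖ < R := by linarith
  have hmem : ∀ w ∈ sphere (0 : ℂ) s, a + w • h ∈ ball a R := by
    intro w hw
    have hw' : ‖w‖ = s := by simpa using hw
    rwa [mem_ball_iff_norm, add_sub_cancel_left, norm_smul, hw']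
  have hrem : (fun t => f (a + h) t - f a t - fderiv ℂ (fun z => f z t) a h) =
      (2 * Real.pi * Complex.I : ℂ)⁻¹ •
        fun t => ∮ w in C(0, s), ((w ^ 2 * (w - 1))⁻¹ • f (a + w • h)) t := by
    ext t
    have := taylor_remainder_eq_circleIntegral (by linarith) (diffContOnCl_slice (hd t) hsR)
    rw [deriv_slice ((hd t).differentiableAt (ball_mem_nhds a hR))] at this
    simpa using this
  have hker : ∀ w ∈ sphere (0 : ℂ) s, w ^ 2 * (w - 1) ≠ 0 ∧
      ‖(w ^ 2 * (w - 1))⁻¹‖ ≤ (s ^ 2 * (s - 1))⁻¹ := by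
    intro w hw
    have hw' : ‖w‖ = s := by simpa using hw
    have h1 : s - 1 ≤ ‖w - 1‖ := by simpa [hw'] using norm_sub_norm_le w 1
    refine ⟨mul_ne_zero (pow_ne_zero _ (norm_pos_iff.1 (by linarith)))
      (norm_pos_iff.1 (by linarith)), ?_⟩
    rw [norm_inv, norm_mul, norm_pow, hw']
    have : 0 < s - 1 := by linarith
    gcongr
  obtain ⟨h1, h2⟩ := eLpNorm_circleIntegral_le (μ := μ) hp (c := 0) (R := s)
    (g := fun w => (w ^ 2 * (w - 1))⁻¹ • f (a + w • h))
    (C := ENNReal.ofReal ((s ^ 2 * (s - 1))⁻¹) * C) (by linarith)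
    (fun t => by
      refine ContinuousOn.smul (ContinuousOn.inv₀ (by fun_prop) fun w hw => (hker w hw).1) ?_
      exact (hd t).continuousOn.comp (by fun_prop) hmem)
    (fun w hw => (hm _ (hmem w hw)).const_smul _)
    (fun w hw => by
      rw [eLpNorm_const_smul, ← ofReal_norm]
      gcongr
      · exact (hker w hw).2
      · exact hC _ (hmem w hw))
  rw [hrem]
  refine ⟨h1.const_smul _, ?_⟩
  rw [eLpNorm_const_smul]
  refine (mul_le_mul_right h2 _).trans ?_
  rw [← ofReal_norm, ← mul_assoc, ← mul_assoc, ← ENNReal.ofReal_mul (by positivity),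
    ← ENNReal.ofReal_mul (by positivity)]
  gcongr
  have hn : ‖(2 * Real.pi * Complex.I : ℂ)⁻¹‖ = (2 * Real.pi)⁻¹ := by
    simp [abs_of_pos Real.pi_pos]
  rw [hn]
  have e1 : (2 * Real.pi)⁻¹ * (2 * Real.pi * s) * (s ^ 2 * (s - 1))⁻¹ = (s * (s - 1))⁻¹ := by
    have : 0 < s - 1 := by linarith
    field_simp
  have e2 : 8 * ‖h‖ ^ 2 / R ^ 2 = (s ^ 2 / 2)⁻¹ := by rw [hs]; field_simp; norm_num
  rw [e1, e2]
  gcongr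
  nlinarith

/-- Cauchy's estimate for the Fréchet derivative. -/
theorem norm_fderiv_le_of_forall_mem_ball {E : Type*} [NormedAddCommGroup E] [NormedSpace ℂ E]
    {f : V → E} {a : V} {R C : ℝ} (hR : 0 < R) (hf : DifferentiableOn ℂ f (ball a R))
    (hC : ∀ z ∈ ball a R, ‖f z‖ ≤ C) : ‖fderiv ℂ f a‖ ≤ 2 * C / R := by
  refine Complex.norm_fderiv_le_div_of_mapsTo_ball hf (fun z hz => ?_) hR
  rw [mem_closedBall_iff_norm]
  have h1 := hC z hz
  have h2 := hC a (mem_ball_self hR)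
  linarith [norm_sub_le (f z) (f a)]

/-- Derivatives of a holomorphic map are locally bounded. -/
theorem exists_eventually_norm_fderiv_le {E : Type*} [NormedAddCommGroup E] [NormedSpace ℂ E]
    {f : V → E} {O : Set V} (hO : IsOpen O) (hf : DifferentiableOn ℂ f O) {a : V} (ha : a ∈ O) :
    ∃ C : ℝ, ∀ᶠ z in 𝓝 a, ‖fderiv ℂ f z‖ ≤ C := by
  have hc := (hf.continuousOn.continuousAt (hO.mem_nhds ha)).norm
  have hev : ∀ᶠ z in 𝓝 a, ‖f z‖ < ‖f a‖ + 1 := hc.eventually_lt_const (by linarith)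
  obtain ⟨R, hR, hball⟩ := Metric.mem_nhds_iff.1 (inter_mem (hO.mem_nhds ha) hev)
  refine ⟨2 * (‖f a‖ + 1) / (R / 2), ?_⟩
  filter_upwards [ball_mem_nhds a (half_pos hR)] with z hz
  have hsub : ball z (R / 2) ⊆ ball a R := ball_subset_ball' (by
    rw [mem_ball] at hz; linarith)
  exact norm_fderiv_le_of_forall_mem_ball (half_pos hR)
    (hf.mono fun w hw => (hball (hsub hw)).1) fun w hw => (hball (hsub hw)).2.le

/-- Directional derivatives of a holomorphic function on a finite-dimensional space are
holomorphic. -/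
theorem differentiableOn_fderiv_apply [FiniteDimensional ℂ V] {f : V → ℂ} {O : Set V}
    (hO : IsOpen O) (hf : DifferentiableOn ℂ f O) (v : V) :
    DifferentiableOn ℂ (fun z => fderiv ℂ f z v) O := by
  intro a ha
  refine DifferentiableAt.differentiableWithinAt ?_
  borelize V
  obtain ⟨K, hK⟩ := exists_eventually_norm_fderiv_le hO hf ha
  obtain ⟨R, hR, hball⟩ := Metric.mem_nhds_iff.1 (inter_mem (hO.mem_nhds ha) hK)
  set s : ℝ := R / (4 * (‖v‖ + 1)) with hs
  have hs0 : 0 < s := by positivity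
  have hsv : s * ‖v‖ < R / 2 := by
    rw [hs, div_mul_eq_mul_div, div_lt_iff₀ (by positivity)]
    nlinarith [norm_nonneg v]
  have hsub : ∀ z ∈ ball a (R / 2), ball z (R / 2) ⊆ ball a R := fun z hz =>
    ball_subset_ball' (by rw [mem_ball] at hz; linarith)
  have hmem : ∀ z ∈ ball a (R / 2), ∀ θ, z + circleMap 0 s θ • v ∈ ball a R := by
    refine fun z hz θ => hsub z hz ?_
    rwa [mem_ball_iff_norm, add_sub_cancel_left, norm_smul, norm_circleMap_zero, abs_of_pos hs0]
  set k : ℝ → ℂ := fun θ => circleMap 0 s θ * Complex.I * ((circleMap 0 s θ) ^ 2)⁻¹ with hk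
  have hc0 : Continuous (circleMap 0 s) := continuous_circleMap 0 s
  have hkc : Continuous k := (hc0.mul continuous_const).mul
    ((hc0.pow 2).inv₀ fun θ => pow_ne_zero _ (circleMap_ne_center hs0.ne'))
  have hkn : ∀ θ, ‖k θ‖ = s⁻¹ := by
    intro θ
    simp only [hk, norm_mul, norm_inv, norm_pow, norm_circleMap_zero, abs_of_pos hs0,
      Complex.norm_I]
    field_simp
  have hrep : (fun z => fderiv ℂ f z v) =ᶠ[𝓝 a] fun z => (2 * Real.pi * Complex.I : ℂ)⁻¹ *
      ∫ θ in (0 : ℝ)..2 * Real.pi, k θ * f (z + circleMap 0 s θ • v) := by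
    filter_upwards [ball_mem_nhds a (half_pos hR)] with z hz
    have hfz : DifferentiableOn ℂ f (ball z (R / 2)) :=
      hf.mono fun w hw => (hball (hsub z hz hw)).1
    have := (diffContOnCl_slice hfz hsv).deriv_eq_smul_circleIntegral hs0
    rw [deriv_slice (hfz.differentiableAt (ball_mem_nhds z (half_pos hR)))] at this
    rw [← inv_smul_smul₀ Complex.two_pi_I_ne_zero (fderiv ℂ f z v), ← this, smul_eq_mul]
    congr 1
    refine intervalIntegral.integral_congr fun θ _ => ?_
    simp [hk, deriv_circleMap, mul_assoc]
  refine DifferentiableAt.congr_of_eventuallyEq ?_ hrep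
  refine DifferentiableAt.const_mul ?_ _
  have hcont : ∀ z ∈ ball a (R / 2),
      Continuous fun θ => k θ * f (z + circleMap 0 s θ • v) := by
    intro z hz
    refine hkc.mul ?_
    refine (hf.continuousOn.mono fun w hw => (hball hw).1).comp_continuous
      (s := ball a R) (by fun_prop) (hmem z hz)
  refine (intervalIntegral.hasFDerivAt_integral_of_dominated_of_fderiv_le
    (μ := volume) (a := 0) (b := 2 * Real.pi)
    (F' := fun z θ => k θ • fderiv ℂ f (z + circleMap 0 s θ • v)) (bound := fun _ => s⁻¹ * K)
    (ball_mem_nhds a (half_pos hR)) ?_ ?_ ?_ ?_ ?_ ?_).differentiableAt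
  · filter_upwards [ball_mem_nhds a (half_pos hR)] with z hz
    exact (hcont z hz).aestronglyMeasurable
  · exact (hcont a (mem_ball_self (half_pos hR))).intervalIntegrable _ _
  · have hm : Measurable fun θ : ℝ => fderiv ℂ f (a + circleMap 0 s θ • v) :=
      (measurable_fderiv ℂ f).comp (by fun_prop : Continuous fun θ : ℝ =>
        a + circleMap 0 s θ • v).measurable
    exact hkc.aestronglyMeasurable.smul hm.aestronglyMeasurable
  · refine ae_of_all _ fun θ _ z hz => ?_
    rw [norm_smul, hkn]
    gcongr
    exact (hball (hmem z hz θ)).2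
  · simp
  · refine ae_of_all _ fun θ _ z hz => ?_
    have h1 : HasFDerivAt f (fderiv ℂ f (z + circleMap 0 s θ • v)) (z + circleMap 0 s θ • v) :=
      (hf.differentiableAt (hO.mem_nhds (hball (hmem z hz θ)).1)).hasFDerivAt
    exact ((hasFDerivAt_comp_add_right _).2 h1).const_mul (k θ)

/-- A locally bounded `L^p`-valued map represented by a family of holomorphic functions is
holomorphic, and its derivative is represented by the derivatives of the family. -/
theorem Lp_differentiableAt_of_represented [FiniteDimensional ℂ V] [Fact (1 ≤ p)] {O : Set V}
    (hO : IsOpen O) {F : V → Lp ℂ p μ} {f : V → Ω → ℂ} (hFf : ∀ z ∈ O, F z =ᵐ[μ] f z)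
    (hd : ∀ t, DifferentiableOn ℂ (fun z => f z t) O) {a : V} (ha : a ∈ O)
    (hb : ∃ C : ℝ, ∀ᶠ z in 𝓝 a, ‖F z‖ ≤ C) :
    DifferentiableAt ℂ F a ∧
      ∀ v, fderiv ℂ F a v =ᵐ[μ] fun t => fderiv ℂ (fun z => f z t) a v := by
  obtain ⟨C, hC⟩ := hb
  obtain ⟨R, hR, hball⟩ := Metric.mem_nhds_iff.1 (inter_mem (hO.mem_nhds ha) hC)
  have hm : ∀ z ∈ ball a R, AEStronglyMeasurable (f z) μ := fun z hz =>
    (Lp.aestronglyMeasurable (F z)).congr (hFf z (hball hz).1)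
  have hCb : ∀ z ∈ ball a R, eLpNorm (f z) p μ ≤ ENNReal.ofReal C := by
    intro z hz
    rw [← eLpNorm_congr_ae (hFf z (hball hz).1), ← Lp.enorm_def, ← ofReal_norm]
    exact ENNReal.ofReal_le_ofReal (hball hz).2
  have hC0 : 0 ≤ C := (norm_nonneg _).trans (hball (mem_ball_self hR)).2
  have hdR : ∀ t, DifferentiableOn ℂ (fun z => f z t) (ball a R) := fun t =>
    (hd t).mono fun z hz => (hball hz).1
  have hrem := fun h (hh : ‖h‖ ≤ R / 4) =>
    eLpNorm_taylor_remainder_le (Fact.out : 1 ≤ p) hR hm hCb hdR hh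
  have hmemLp : ∀ z ∈ ball a R, MemLp (f z) p μ := fun z hz =>
    ⟨hm z hz, (hCb z hz).trans_lt ENNReal.ofReal_lt_top⟩
  have hin : ∀ h : V, ‖h‖ ≤ R / 4 → a + h ∈ ball a R := fun h hh => by
    rw [mem_ball_iff_norm, add_sub_cancel_left]; linarith
  have hsmall : ∀ h : V, ‖h‖ ≤ R / 4 →
      MemLp (fun t => fderiv ℂ (fun z => f z t) a h) p μ := by
    intro h hh
    have h1 : MemLp (fun t => f (a + h) t - f a t - fderiv ℂ (fun z => f z t) a h) p μ :=
      ⟨(hrem h hh).1, (hrem h hh).2.trans_lt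
        (ENNReal.mul_lt_top ENNReal.ofReal_lt_top ENNReal.ofReal_lt_top)⟩
    have h2 := ((hmemLp _ (hin h hh)).sub (hmemLp a (mem_ball_self hR))).sub h1
    refine (memLp_congr_ae (ae_of_all _ fun t => ?_)).1 h2
    simp
  have hall : ∀ v : V, MemLp (fun t => fderiv ℂ (fun z => f z t) a v) p μ := by
    intro v
    set c : ℝ := R / (4 * (‖v‖ + 1)) with hc
    have hc0 : 0 < c := by positivity
    have hcv : ‖(c : ℂ) • v‖ ≤ R / 4 := by
      rw [norm_smul, Complex.norm_real, Real.norm_of_nonneg hc0.le, hc, div_mul_eq_mul_div,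
        div_le_iff₀ (by positivity)]
      nlinarith [norm_nonneg v]
    have h1 := (hsmall _ hcv).const_smul ((c : ℂ)⁻¹)
    refine (memLp_congr_ae (ae_of_all _ fun t => ?_)).1 h1
    have : (c : ℂ) ≠ 0 := by exact_mod_cast hc0.ne'
    simp [this]
  let L : V →ₗ[ℂ] Lp ℂ p μ :=
    { toFun := fun v => (hall v).toLp _
      map_add' := fun v w => by
        rw [← MemLp.toLp_add]
        exact MemLp.toLp_congr _ _ (ae_of_all _ fun t => by simp)
      map_smul' := fun c v => by
        rw [RingHom.id_apply, ← MemLp.toLp_const_smul]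
        exact MemLp.toLp_congr _ _ (ae_of_all _ fun t => by simp) }
  have hL : HasFDerivAt F L.toContinuousLinearMap a := by
    rw [hasFDerivAt_iff_isLittleO_nhds_zero]
    refine Asymptotics.IsBigO.trans_isLittleO (g := fun h : V => ‖h‖ ^ 2) ?_ ?_
    · refine Asymptotics.IsBigO.of_bound (8 / R ^ 2 * C) ?_
      filter_upwards [closedBall_mem_nhds (0 : V) (by positivity : 0 < R / 4)] with h hh
      have hh' : ‖h‖ ≤ R / 4 := by simpa using hh
      have hae : (F (a + h) - F a - L h : Lp ℂ p μ) =ᵐ[μ]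
          fun t => f (a + h) t - f a t - fderiv ℂ (fun z => f z t) a h := by
        filter_upwards [Lp.coeFn_sub (F (a + h) - F a) (L h), Lp.coeFn_sub (F (a + h)) (F a),
          hFf _ (hball (hin h hh')).1, hFf a ha, (hall h).coeFn_toLp] with t h1 h2 h3 h4 h5
        rw [h1, Pi.sub_apply, h2, Pi.sub_apply, h3, h4]
        congr 1
      change ‖F (a + h) - F a - L h‖ ≤ _
      rw [Lp.norm_def, eLpNorm_congr_ae hae]
      refine ENNReal.toReal_le_of_le_ofReal (by positivity) ((hrem h hh').2.trans (le_of_eq ?_))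
      rw [← ENNReal.ofReal_mul (by positivity), norm_pow, norm_norm]
      congr 1
      ring
    · simpa using Asymptotics.isLittleO_norm_pow_id (E' := V) one_lt_two
  refine ⟨hL.differentiableAt, fun v => ?_⟩
  rw [hL.fderiv]
  exact (hall v).coeFn_toLp

/-- `F` is holomorphic on `O` and its values are represented by the family `f` of functions
holomorphic on `O`. -/
structure IsHolomorphicRep (O : Set V) (F : V → Lp ℂ p μ) (f : Ω → V → ℂ) [Fact (1 ≤ p)] :
    Prop where
  differentiableOn : DifferentiableOn ℂ F O
  ae_eq : ∀ z ∈ O, F z =ᵐ[μ] fun t => f t z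
  differentiableOn_apply : ∀ t, DifferentiableOn ℂ (f t) O

theorem IsHolomorphicRep.pderiv [Fact (1 ≤ p)] {d : ℕ} {O : Set (Fin d → ℂ)} (hO : IsOpen O)
    {F : (Fin d → ℂ) → Lp ℂ p μ} {f : Ω → (Fin d → ℂ) → ℂ} (h : IsHolomorphicRep O F f)
    (j : Fin d) : IsHolomorphicRep O (pderiv' j F) (fun t => pderiv' j (f t)) := by
  have hF := fun a ha => Lp_differentiableAt_of_represented hO (f := fun z t => f t z) h.ae_eq
    h.differentiableOn_apply (a := a) ha
  have hae : ∀ z ∈ O, (pderiv' j F z : Lp ℂ p μ) =ᵐ[μ] fun t => pderiv' j (f t) z := by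
    refine fun z hz => (hF z hz ⟨‖F z‖ + 1, ?_⟩).2 _
    have := (h.differentiableOn.continuousOn.continuousAt (hO.mem_nhds hz)).norm
    filter_upwards [this.eventually_lt_const (lt_add_one _)] with w hw using hw.le
  have hd : ∀ t, DifferentiableOn ℂ (pderiv' j (f t)) O := fun t =>
    differentiableOn_fderiv_apply hO (h.differentiableOn_apply t) _
  refine ⟨fun a ha => DifferentiableAt.differentiableWithinAt ?_, hae, hd⟩
  refine (Lp_differentiableAt_of_represented hO (f := fun z t => pderiv' j (f t) z) hae hd
    ha ?_).1
  obtain ⟨C, hC⟩ := exists_eventually_norm_fderiv_le hO h.differentiableOn ha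
  refine ⟨C * ‖(Pi.single j 1 : Fin d → ℂ)‖, ?_⟩
  filter_upwards [hC] with z hz
  exact ContinuousLinearMap.le_of_opNorm_le _ hz _

theorem IsHolomorphicRep.iterate_pderiv [Fact (1 ≤ p)] {d : ℕ} {O : Set (Fin d → ℂ)}
    (hO : IsOpen O) {F : (Fin d → ℂ) → Lp ℂ p μ} {f : Ω → (Fin d → ℂ) → ℂ}
    (h : IsHolomorphicRep O F f) (j : Fin d) (n : ℕ) :
    IsHolomorphicRep O ((pderiv' j)^[n] F) (fun t => (pderiv' j)^[n] (f t)) := by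
  induction n with
  | zero => exact h
  | succ n ih =>
    simp only [Function.iterate_succ_apply']
    exact ih.pderiv hO j

theorem IsHolomorphicRep.dpartial [Fact (1 ≤ p)] {d : ℕ} {O : Set (Fin d → ℂ)}
    (hO : IsOpen O) {F : (Fin d → ℂ) → Lp ℂ p μ} {f : Ω → (Fin d → ℂ) → ℂ}
    (h : IsHolomorphicRep O F f) (α : Fin d → ℕ) :
    IsHolomorphicRep O (Dpartial α F) (fun t => Dpartial α (f t)) := by
  unfold Dpartial
  suffices H : ∀ (n : ℕ) (e : Fin n → Fin d),
      IsHolomorphicRep O (Fin.foldr n (fun i g => (pderiv' (e i))^[α (e i)] g) F)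
        (fun t => Fin.foldr n (fun i g => (pderiv' (e i))^[α (e i)] g) (f t)) from H d id
  intro n
  induction n with
  | zero => simpa using h
  | succ n ih =>
    intro e
    simp only [Fin.foldr_succ]
    exact (ih fun i => e i.succ).iterate_pderiv hO _ _

end Helpers

/-- Let `(Ω,Σ,μ)` be a measure space, `1 ≤ p < ∞`, `O ⊆ ℂᵈ` open, and
`f : O × Ω → ℂ` with `f(z,·)` measurable for each `z` and
`sup_{z∈O} ∫ |f(z,t)|^p dμ < ∞`, and `f(·,t)` bounded holomorphic for each `t`.
Then the map `F : O → L^p(Ω)`, `F z = [f(z,·)]`, is bounded and holomorphic, and for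
every multi-index `α` and `a ∈ O`, `D^α F(a) = D^α_z f(a,·)` μ-a.e. -/
theorem holomorphy_into_Lp
    {d : ℕ} (O : Set (Fin d → ℂ)) (hO : IsOpen O)
    {Ω : Type*} [MeasurableSpace Ω] (μ : Measure Ω)
    (p : ℝ≥0∞) [Fact (1 ≤ p)] (hp : p ≠ ∞)
    (f : (Fin d → ℂ) → Ω → ℂ)
    (hmeas : ∀ z ∈ O, Measurable (f z))
    (hLp : ∃ C : ℝ≥0∞, C < ∞ ∧ ∀ z ∈ O, eLpNorm (f z) p μ ≤ C)
    (hholo : ∀ t : Ω, DifferentiableOn ℂ (fun z => f z t) O)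
    (hbdd : ∀ t : Ω, ∃ C : ℝ, ∀ z ∈ O, ‖f z t‖ ≤ C) :
    ∃ F : (Fin d → ℂ) → Lp ℂ p μ,
      (∀ z ∈ O, ∀ᵐ t ∂μ, (F z : Ω → ℂ) t = f z t) ∧
      DifferentiableOn ℂ F O ∧ (∃ C : ℝ, ∀ z ∈ O, ‖F z‖ ≤ C) ∧
      ∀ (α : Fin d → ℕ), ∀ a ∈ O,
        ∀ᵐ t ∂μ, (↑↑(Dpartial α F a) : Ω → ℂ) t = Dpartial α (fun z => f z t) a := by
  classical
  obtain ⟨C, hC, hb⟩ := hLp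
  have hmem : ∀ z ∈ O, MemLp (f z) p μ := fun z hz =>
    ⟨(hmeas z hz).aestronglyMeasurable, (hb z hz).trans_lt hC⟩
  let F : (Fin d → ℂ) → Lp ℂ p μ := fun z => if hz : z ∈ O then (hmem z hz).toLp (f z) else 0
  have hF : ∀ z (hz : z ∈ O), F z = (hmem z hz).toLp (f z) := fun z hz => dif_pos hz
  have hFf : ∀ z ∈ O, F z =ᵐ[μ] f z := fun z hz => by
    rw [hF z hz]
    exact (hmem z hz).coeFn_toLp
  have hFb : ∀ z ∈ O, ‖F z‖ ≤ C.toReal := fun z hz => by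
    rw [hF z hz, Lp.norm_toLp]
    exact ENNReal.toReal_mono hC.ne (hb z hz)
  have hFd : DifferentiableOn ℂ F O := fun a ha =>
    (Lp_differentiableAt_of_represented hO hFf hholo ha ⟨C.toReal, by
      filter_upwards [hO.mem_nhds ha] with z hz using hFb z hz⟩).1.differentiableWithinAt
  have hrep : IsHolomorphicRep O F fun t z => f z t := ⟨hFd, hFf, hholo⟩
  exact ⟨F, hFf, hFd, ⟨C.toReal, hFb⟩, fun α => (hrep.dpartial hO α).ae_eq⟩
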